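/- Let n ≥ 2, 0 ≤ q ≤ n, s, k positive integers, 0 < λ < λ' < 1, δ > n/2, μ > 0, T > 0, and let w ∈ F^{k,s(s,λ,λ',δ)}_{T,Λ^q}. Suppose a q-form u ∈ F^{k,s(s,λ,λ',δ)}_{T,Λ^q} satisfies ∂_t u − μΔu + B_q(w,u) = 0 on ℝⁿ×(0,T) and u(·,0) = 0 on ℝⁿ. Then u ≡ 0 on ℝⁿ×[0,T]. -/

import Mathlib

open scoped BigOperators ENNReal Classical
open Filter MeasureTheory

noncomputable section

namespace NSdeRham

/-- Euclidean space `ℝⁿ`. -/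
abbrev Spc (n : ℕ) := EuclideanSpace ℝ (Fin n)

variable {n : ℕ}

/-- The weight `w(x) = √(1+|x|²)`. -/
def wt (x : Spc n) : ℝ := Real.sqrt (1 + ‖x‖ ^ 2)

/-- `w(x,y) = max (w x) (w y)`. -/
def wt2 (x y : Spc n) : ℝ := max (wt x) (wt y)

/-- Partial derivative in the `i`-th coordinate direction. -/
def pd (i : Fin n) (f : Spc n → ℝ) (x : Spc n) : ℝ :=
  fderiv ℝ f x (EuclideanSpace.single i 1)

/-- The Laplace operator `Δ = ∑ ∂²/∂xᵢ²`. -/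
def lap (f : Spc n → ℝ) (x : Spc n) : ℝ := ∑ i : Fin n, pd i (pd i f) x

section enorms

variable {F : Type*} [NormedAddCommGroup F]

/-- Weighted sup-"norm" `sup_x w(x)^δ ‖g x‖` (with values in `ℝ≥0∞`). -/
def eWSup (δ : ℝ) (g : Spc n → F) : ℝ≥0∞ :=
  ⨆ x : Spc n, ENNReal.ofReal (wt x ^ δ * ‖g x‖)

/-- Weighted Hölder seminorm `⟨g⟩_{λ,δ}`. -/
def eWHold (lam δ : ℝ) (g : Spc n → F) : ℝ≥0∞ :=
  ⨆ (x : Spc n) (y : Spc n) (_ : x ≠ y ∧ ‖x - y‖ ≤ ‖x‖ / 2),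
    ENNReal.ofReal (wt2 x y ^ (δ + lam) * ‖g x - g y‖ / ‖x - y‖ ^ lam)

/-- The ordinary Hölder norm on the (closed) unit ball around the origin. -/
def eOHold (lam : ℝ) (g : Spc n → F) : ℝ≥0∞ :=
  (⨆ (x : Spc n) (_ : ‖x‖ ≤ 1), ENNReal.ofReal ‖g x‖) +
    ⨆ (x : Spc n) (y : Spc n) (_ : ‖x‖ ≤ 1 ∧ ‖y‖ ≤ 1 ∧ x ≠ y),
      ENNReal.ofReal (‖g x - g y‖ / ‖x - y‖ ^ lam)

/-- The norm of `C^{0,λ,δ}`; for `λ = 0` this is just the weighted sup-norm. -/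
def eHol0 (lam δ : ℝ) (g : Spc n → F) : ℝ≥0∞ :=
  if lam = 0 then eWSup δ g else eOHold lam g + eWSup δ g + eWHold lam δ g

/-- The norm of the base anisotropic space `C^{𝐬(0,λ,δ)}_T`. -/
def eAniso0 (T lam δ : ℝ) (v : ℝ → Spc n → F) : ℝ≥0∞ :=
  (⨆ t : Set.Icc (0 : ℝ) T, eHol0 lam δ (v t)) +
    if lam = 0 then 0 else
      ⨆ (t₁ : Set.Icc (0 : ℝ) T) (t₂ : Set.Icc (0 : ℝ) T) (_ : (t₁ : ℝ) ≠ (t₂ : ℝ))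
        (x : Spc n),
        ENNReal.ofReal (wt x ^ δ * ‖v t₁ x - v t₂ x‖ / |(t₁ : ℝ) - (t₂ : ℝ)| ^ (lam / 2))

end enorms

/-- The norm of the static weighted Hölder space `C^{s,λ,δ}`. -/
def eHolS (s : ℕ) (lam δ : ℝ) (g : Spc n → ℝ) : ℝ≥0∞ :=
  ∑ m ∈ Finset.range (s + 1), eHol0 lam (δ + m) (iteratedFDeriv ℝ m g)

/-- Membership in the static weighted Hölder space `C^{s,λ,δ}`. -/
def HolSMem (s : ℕ) (lam δ : ℝ) (g : Spc n → ℝ) : Prop :=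
  ContDiff ℝ s g ∧ eHolS s lam δ g ≠ ⊤

/-- Time derivative of order `j` (within `[0,T]`). -/
def tDeriv (T : ℝ) (j : ℕ) (u : ℝ → Spc n → ℝ) (t : ℝ) (x : Spc n) : ℝ :=
  iteratedDerivWithin j (fun τ => u τ x) (Set.Icc 0 T) t

/-- Mixed derivative `∂_x^m ∂_t^j`. -/
def mixDeriv (T : ℝ) (m j : ℕ) (u : ℝ → Spc n → ℝ) (t : ℝ) :
    Spc n → ContinuousMultilinearMap ℝ (fun _ : Fin m => Spc n) ℝ :=
  iteratedFDeriv ℝ m (fun x => tDeriv T j u t x)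

/-- The norm of the anisotropic weighted parabolic Hölder space `C^{k,𝐬(s,λ,δ)}_T`. -/
def eAnisoKS (T : ℝ) (k s : ℕ) (lam δ : ℝ) (u : ℝ → Spc n → ℝ) : ℝ≥0∞ :=
  ∑ b ∈ Finset.range (k + 1), ∑ m ∈ Finset.range (2 * s + 1), ∑ j ∈ Finset.range (s + 1),
    if m + 2 * j ≤ 2 * s then eAniso0 T lam (δ + b + m) (mixDeriv T (b + m) j u) else 0

/-- Regularity required of members of `C^{k,𝐬(s,λ,δ)}_T`. -/
def AnisoReg (T : ℝ) (k s : ℕ) (u : ℝ → Spc n → ℝ) : Prop :=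
  (∀ x : Spc n, ContDiffOn ℝ s (fun t => u t x) (Set.Icc 0 T)) ∧
  (∀ j : ℕ, j ≤ s → ∀ t ∈ Set.Icc (0 : ℝ) T,
    ContDiff ℝ (2 * (s - j) + k) (fun x => tDeriv T j u t x)) ∧
  (∀ j m : ℕ, j ≤ s → m + 2 * j ≤ 2 * s + k →
    Continuous fun p : Set.Icc (0 : ℝ) T × Spc n => mixDeriv T m j u p.1 p.2)

/-- Membership in `C^{k,𝐬(s,λ,δ)}_T`. -/
def AnisoMem (T : ℝ) (k s : ℕ) (lam δ : ℝ) (u : ℝ → Spc n → ℝ) : Prop :=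
  AnisoReg T k s u ∧ eAnisoKS T k s lam δ u ≠ ⊤

/-- The norm of `𝓕^{k,𝐬(s,λ,λ',δ)}_T = C^{k+1,𝐬(s,λ,δ)}_T ∩ C^{k,𝐬(s,λ',δ)}_T`. -/
def eFn (T : ℝ) (k s : ℕ) (lam lam' δ : ℝ) (u : ℝ → Spc n → ℝ) : ℝ≥0∞ :=
  eAnisoKS T (k + 1) s lam δ u + eAnisoKS T k s lam' δ u

/-- Membership in `𝓕^{k,𝐬(s,λ,λ',δ)}_T`. -/
def FMem (T : ℝ) (k s : ℕ) (lam lam' δ : ℝ) (u : ℝ → Spc n → ℝ) : Prop :=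
  AnisoReg T (k + 1) s u ∧ eFn T k s lam lam' δ u ≠ ⊤

/-- Index set of a basis of `Λ^q`. -/
abbrev Idx (n q : ℕ) := {I : Finset (Fin n) // I.card = q}

/-- Static differential `q`-forms: coefficient functions. -/
abbrev FormS (n q : ℕ) := Idx n q → Spc n → ℝ

/-- Time-dependent differential `q`-forms. -/
abbrev FormT (n q : ℕ) := Idx n q → ℝ → Spc n → ℝ

/-- Fibre of the bundle `Λ^q`. -/
abbrev Fib (n q : ℕ) := Idx n q → ℝ

/-- The exterior derivative `d_q` on static `q`-forms. -/
def dS {q : ℕ} (u : FormS n q) : FormS n (q + 1) := fun J x =>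
  ∑ i : Fin n,
    if h : i ∈ J.1 then
      (-1 : ℝ) ^ (J.1.filter fun j => j < i).card *
        pd i (u ⟨J.1.erase i, by simp [Finset.card_erase_of_mem h, J.2]⟩) x
    else 0

/-- The exterior derivative `d_{q-1}` mapping `(q-1)`-forms to `q`-forms. -/
def dLowS {q : ℕ} (p : FormS n (q - 1)) : FormS n q := fun J x =>
  ∑ i : Fin n,
    if h : i ∈ J.1 ∧ (J.1.erase i).card = q - 1 then
      (-1 : ℝ) ^ (J.1.filter fun j => j < i).card * pd i (p ⟨J.1.erase i, h.2⟩) x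
    else 0

/-- The formal adjoint `d_{q-1}^*` mapping `q`-forms to `(q-1)`-forms. -/
def coDS {q : ℕ} (u : FormS n q) : FormS n (q - 1) := fun K x =>
  -∑ i : Fin n,
    if h : i ∉ K.1 ∧ (insert i K.1).card = q then
      (-1 : ℝ) ^ (K.1.filter fun j => j < i).card * pd i (u ⟨insert i K.1, h.2⟩) x
    else 0

/-- `d_q` on time-dependent forms. -/
def dT {q : ℕ} (u : FormT n q) : FormT n (q + 1) := fun J t => dS (fun I => u I t) J

/-- `d_{q-1}` on time-dependent forms. -/
def dLowT {q : ℕ} (p : FormT n (q - 1)) : FormT n q := fun J t => dLowS (fun I => p I t) J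

/-- `d_{q-1}^*` on time-dependent forms. -/
def coDT {q : ℕ} (u : FormT n q) : FormT n (q - 1) := fun K t => coDS (fun I => u I t) K

/-- Norm of `C^{k,𝐬(s,λ,δ)}_{T,Λ^q}`. -/
def eAnisoKSF {q : ℕ} (T : ℝ) (k s : ℕ) (lam δ : ℝ) (u : FormT n q) : ℝ≥0∞ :=
  ∑ I : Idx n q, eAnisoKS T k s lam δ (u I)

/-- Membership in `C^{k,𝐬(s,λ,δ)}_{T,Λ^q}`. -/
def CMemF {q : ℕ} (T : ℝ) (k s : ℕ) (lam δ : ℝ) (u : FormT n q) : Prop :=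
  (∀ I, AnisoReg T k s (u I)) ∧ eAnisoKSF T k s lam δ u ≠ ⊤

/-- Graph norm of `C^{k,𝐬(s,λ,δ)}_{T,Λ^q,𝒟_{d⊕d*}}`. -/
def eCD {q : ℕ} (T : ℝ) (k s : ℕ) (lam δ : ℝ) (u : FormT n q) : ℝ≥0∞ :=
  eAnisoKSF T k s lam δ u + eAnisoKSF T k s lam (δ + 1) (dT u) +
    eAnisoKSF T k s lam (δ + 1) (coDT u)

/-- Membership in `C^{k,𝐬(s,λ,δ)}_{T,Λ^q,𝒟_{d⊕d*}}`. -/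
def CMemD {q : ℕ} (T : ℝ) (k s : ℕ) (lam δ : ℝ) (u : FormT n q) : Prop :=
  CMemF T k s lam δ u ∧ CMemF T k s lam (δ + 1) (dT u) ∧ CMemF T k s lam (δ + 1) (coDT u)

/-- Norm of `𝓕^{k,𝐬(s,λ,λ',δ)}_{T,Λ^q}`. -/
def eFF {q : ℕ} (T : ℝ) (k s : ℕ) (lam lam' δ : ℝ) (u : FormT n q) : ℝ≥0∞ :=
  ∑ I : Idx n q, eFn T k s lam lam' δ (u I)

/-- Membership in `𝓕^{k,𝐬(s,λ,λ',δ)}_{T,Λ^q}`. -/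
def FMemF {q : ℕ} (T : ℝ) (k s : ℕ) (lam lam' δ : ℝ) (u : FormT n q) : Prop :=
  (∀ I, AnisoReg T (k + 1) s (u I)) ∧ eFF T k s lam lam' δ u ≠ ⊤

/-- Graph norm of `𝓕^{k,𝐬(s,λ,λ',δ)}_{T,Λ^q,𝒟_{d⊕d*}}`. -/
def eFD {q : ℕ} (T : ℝ) (k s : ℕ) (lam lam' δ : ℝ) (u : FormT n q) : ℝ≥0∞ :=
  eFF T k s lam lam' δ u + eFF T k s lam lam' (δ + 1) (dT u) +
    eFF T k s lam lam' (δ + 1) (coDT u)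

/-- Membership in `𝓕^{k,𝐬(s,λ,λ',δ)}_{T,Λ^q,𝒟_{d⊕d*}}`. -/
def FMemD {q : ℕ} (T : ℝ) (k s : ℕ) (lam lam' δ : ℝ) (u : FormT n q) : Prop :=
  FMemF T k s lam lam' δ u ∧ FMemF T k s lam lam' (δ + 1) (dT u) ∧
    FMemF T k s lam lam' (δ + 1) (coDT u)

/-- Norm of the static space `C^{s,λ,δ}_{Λ^q}`. -/
def eHolSF {q : ℕ} (s : ℕ) (lam δ : ℝ) (g : FormS n q) : ℝ≥0∞ :=
  ∑ I : Idx n q, eHolS s lam δ (g I)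

/-- Membership in the static space `C^{s,λ,δ}_{Λ^q}`. -/
def HolMemF {q : ℕ} (s : ℕ) (lam δ : ℝ) (g : FormS n q) : Prop :=
  (∀ I, ContDiff ℝ s (g I)) ∧ eHolSF s lam δ g ≠ ⊤

/-- Equality of time-dependent forms on `ℝⁿ × [0,T]`. -/
def EqOnT {q : ℕ} (T : ℝ) (u v : FormT n q) : Prop :=
  ∀ I, ∀ t ∈ Set.Icc (0 : ℝ) T, ∀ x, u I t x = v I t x

/-- The form `u` is co-closed (`d^* u = 0`) on `ℝⁿ × [0,T]`. -/
def CoClosed {q : ℕ} (T : ℝ) (u : FormT n q) : Prop :=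
  ∀ K, ∀ t ∈ Set.Icc (0 : ℝ) T, ∀ x, coDT u K t x = 0

/-- Type of the bilinear zero order operator `M₁^{(q)}`. -/
abbrev M1Type (n q : ℕ) := (Fib n (q + 1) × Fib n (q - 1)) →ₗ[ℝ] Fib n q →ₗ[ℝ] Fib n q

/-- Type of the bilinear zero order operator `M₂^{(q)}`. -/
abbrev M2Type (n q : ℕ) := Fib n q →ₗ[ℝ] Fib n q →ₗ[ℝ] Fib n (q - 1)

/-- Value of a time-dependent form at a point, as an element of the fibre. -/
def fib {q : ℕ} (u : FormT n q) (t : ℝ) (x : Spc n) : Fib n q := fun I => u I t x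

/-- Value of `(d_q ⊕ d_{q-1}^*) u` at a point. -/
def ddFib {q : ℕ} (u : FormT n q) (t : ℝ) (x : Spc n) : Fib n (q + 1) × Fib n (q - 1) :=
  (fun J => dT u J t x, fun K => coDT u K t x)

/-- The operator `W_q u = M₁((d⊕d^*)u, w) + M₁((d⊕d^*)w, u)`. -/
def Wop {q : ℕ} (M₁ : M1Type n q) (w u : FormT n q) : FormT n q := fun I t x =>
  M₁ (ddFib u t x) (fib w t x) I + M₁ (ddFib w t x) (fib u t x) I

/-- The symmetric bilinearization `B_q(w,u)` of the nonlinearity. -/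
def Bop {q : ℕ} (M₁ : M1Type n q) (M₂ : M2Type n q) (w u : FormT n q) : FormT n q :=
  fun I t x =>
    Wop M₁ w u I t x +
      dLowT (fun K t' x' =>
        M₂ (fib u t' x') (fib w t' x') K + M₂ (fib w t' x') (fib u t' x') K) I t x

/-- The nonlinearity `𝒩_q u = M₁((d⊕d^*)u, u) + d_{q-1} M₂(u,u)`. -/
def Nop {q : ℕ} (M₁ : M1Type n q) (M₂ : M2Type n q) (u : FormT n q) : FormT n q :=
  fun I t x =>
    M₁ (ddFib u t x) (fib u t x) I +
      dLowT (fun K t' x' => M₂ (fib u t' x') (fib u t' x') K) I t x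

/-- Fundamental solution of the heat operator `∂_t - μΔ`. -/
def heatKer (μ : ℝ) (x : Spc n) (t : ℝ) : ℝ :=
  if 0 < t then (4 * Real.pi * μ * t) ^ (-(n : ℝ) / 2) * Real.exp (-‖x‖ ^ 2 / (4 * μ * t))
  else 0

/-- Volume heat potential `Ψ_μ`. -/
def volPot (μ : ℝ) (f : ℝ → Spc n → ℝ) (t : ℝ) (x : Spc n) : ℝ :=
  ∫ τ in Set.Ioc (0 : ℝ) t, ∫ y : Spc n, heatKer μ (x - y) (t - τ) * f τ y

/-- Poisson heat potential `Ψ_{μ,0}`. -/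
def poisPot (μ : ℝ) (g : Spc n → ℝ) (t : ℝ) (x : Spc n) : ℝ :=
  ∫ y : Spc n, heatKer μ (x - y) t * g y

/-- Volume heat potential acting coefficient-wise on forms. -/
def volPotF {q : ℕ} (μ : ℝ) (f : FormT n q) : FormT n q := fun I => volPot μ (f I)

/-- Poisson heat potential acting coefficient-wise on forms. -/
def poisPotF {q : ℕ} (μ : ℝ) (g : FormS n q) : FormT n q := fun I => poisPot μ (g I)

/-- Area of the unit sphere in `ℝⁿ`. -/
def sphArea (n : ℕ) : ℝ := 2 * Real.pi ^ ((n : ℝ) / 2) / Real.Gamma ((n : ℝ) / 2)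

/-- Standard fundamental solution of the Laplace operator in `ℝⁿ`. -/
def lapKer (n : ℕ) (x : Spc n) : ℝ :=
  if n = 2 then (1 / Real.pi) * Real.log ‖x‖
  else ‖x‖ ^ (2 - (n : ℝ)) / (sphArea n * (2 - (n : ℝ)))

/-- Newtonian potential. -/
def newtPot (f : Spc n → ℝ) (x : Spc n) : ℝ := ∫ y : Spc n, lapKer n (x - y) * f y

/-- The integral operator `Φ_q` mapping `(q+1)`-forms to `q`-forms;
concretely `Φ_q f = -d^* (e * f)`. -/
def PhiOp {q : ℕ} (f : FormT n (q + 1)) : FormT n q := fun K t x =>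
  -coDS (n := n) (q := q + 1) (fun J y => newtPot (fun z => f J t z) y) K x

/-- Squared `L²` norm of a form at time `t`. -/
def l2Sq {q : ℕ} (u : FormT n q) (t : ℝ) : ℝ :=
  ∑ I : Idx n q, ∫ x : Spc n, (u I t x) ^ 2

/-- Squared `L²` norm of the spatial gradient of a form at time `t`. -/
def gradSq {q : ℕ} (u : FormT n q) (t : ℝ) : ℝ :=
  ∑ I : Idx n q, ∑ i : Fin n, ∫ x : Spc n, (pd i (fun y => u I t y) x) ^ 2

/-- The norm of `C^{0,𝐬(0,0,δ)}_{T,Λ^q}` (weighted sup-norm). -/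
def eSupT {q : ℕ} (T δ : ℝ) (u : FormT n q) : ℝ≥0∞ :=
  ∑ I : Idx n q,
    ⨆ (t : Set.Icc (0 : ℝ) T) (x : Spc n), ENNReal.ofReal (wt x ^ δ * |u I t x|)

/-- The norm `‖∇u‖_{C^{0,𝐬(0,0,δ)}_{T}}` of the spatial gradient. -/
def eSupGradT {q : ℕ} (T δ : ℝ) (u : FormT n q) : ℝ≥0∞ :=
  ∑ I : Idx n q, ∑ i : Fin n,
    ⨆ (t : Set.Icc (0 : ℝ) T) (x : Spc n),
      ENNReal.ofReal (wt x ^ δ * |pd i (fun y => u I t y) x|)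

/-- `q`-form with coefficients harmonic polynomials of degree at most `m`. -/
def HarmPolyForm {q : ℕ} (m : ℕ) (h : FormS n q) : Prop :=
  ∀ I, (∃ P : MvPolynomial (Fin n) ℝ, P.totalDegree ≤ m ∧
      ∀ x : Spc n, h I x = MvPolynomial.eval (fun i => x i) P) ∧
    ∀ x : Spc n, lap (h I) x = 0

/-- Classical solution of the Cauchy problem
`∂_t u - μ Δ u + extra = f` on `ℝⁿ × (0,T)`, `u(·,0) = u₀`. -/
def CauchySol {q : ℕ} (T μ : ℝ) (u extra f : FormT n q) (u₀ : FormS n q) : Prop :=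
  (∀ I, ∀ t ∈ Set.Ioo (0 : ℝ) T, ∀ x,
    deriv (fun τ => u I τ x) t - μ * lap (fun y => u I t y) x + extra I t x = f I t x) ∧
  ∀ I x, u I 0 x = u₀ I x

/-- `Ψ_{μ,q} 𝒩_q u`. -/
def NopPot {q : ℕ} (μ : ℝ) (M₁ : M1Type n q) (M₂ : M2Type n q) (u : FormT n q) : FormT n q :=
  volPotF μ (Nop M₁ M₂ u)

/-- `u + Ψ_{μ,q} 𝒩_q u`. -/
def TmapN {q : ℕ} (μ : ℝ) (M₁ : M1Type n q) (M₂ : M2Type n q) (u : FormT n q) : FormT n q :=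
  u + NopPot μ M₁ M₂ u

/-- The linearization `u + Ψ_{μ,q} B_q(v,u)`. -/
def LmapB {q : ℕ} (μ : ℝ) (M₁ : M1Type n q) (M₂ : M2Type n q) (v u : FormT n q) :
    FormT n q :=
  u + volPotF μ (Bop M₁ M₂ v u)

/-- `Φ_q d_q Ψ_{μ,q} 𝒩_q u`. -/
def PhiNpot {q : ℕ} (μ : ℝ) (M₁ : M1Type n q) (M₂ : M2Type n q) (u : FormT n q) :
    FormT n q :=
  PhiOp (dT (volPotF μ (Nop M₁ M₂ u)))

/-- `u + Φ_q d_q Ψ_{μ,q} 𝒩_q u`. -/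
def PhiNmap {q : ℕ} (μ : ℝ) (M₁ : M1Type n q) (M₂ : M2Type n q) (u : FormT n q) :
    FormT n q :=
  u + PhiNpot μ M₁ M₂ u

/-- The linearization `u + Φ_q d_q Ψ_{μ,q} B_q(v,u)`. -/
def PhiLmap {q : ℕ} (μ : ℝ) (M₁ : M1Type n q) (M₂ : M2Type n q) (v u : FormT n q) :
    FormT n q :=
  u + PhiOp (dT (volPotF μ (Bop M₁ M₂ v u)))

theorem one_le_wt (x : Spc n) : 1 ≤ wt x := by
  unfold wt
  rw [Real.one_le_sqrt]
  nlinarith [sq_nonneg ‖x‖]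

theorem norm_le_wt (x : Spc n) : ‖x‖ ≤ wt x := by
  unfold wt
  apply Real.le_sqrt_of_sq_le
  linarith

theorem exists_bound_of_eAniso0_ne_top {F : Type*} [NormedAddCommGroup F] {T lam δ : ℝ}
    (hlam : lam ≠ 0) {v : ℝ → Spc n → F} (h : eAniso0 T lam δ v ≠ ⊤) :
    ∃ W : ℝ, ∀ t ∈ Set.Icc (0 : ℝ) T, ∀ x, wt x ^ δ * ‖v t x‖ ≤ W := by
  refine ⟨(eAniso0 T lam δ v).toReal, fun t ht x => ?_⟩
  rw [← ENNReal.ofReal_le_iff_le_toReal h]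
  have e1 : ENNReal.ofReal (wt x ^ δ * ‖v t x‖) ≤ eWSup δ (v t) :=
    le_iSup (fun x : Spc n => ENNReal.ofReal (wt x ^ δ * ‖v t x‖)) x
  have e2 : eWSup δ (v t) ≤ eHol0 lam δ (v t) := by
    unfold eHol0
    rw [if_neg hlam]
    exact le_add_right le_add_self
  have e3 : eHol0 lam δ (v t) ≤ ⨆ t : Set.Icc (0 : ℝ) T, eHol0 lam δ (v t) :=
    le_iSup (fun t : Set.Icc (0 : ℝ) T => eHol0 lam δ (v t)) ⟨t, ht⟩
  exact e1.trans (e2.trans (e3.trans le_self_add))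

theorem eAniso0_ne_top_of_eAnisoKS {T lam δ : ℝ} {k s b m j : ℕ} {u : ℝ → Spc n → ℝ}
    (h : eAnisoKS T k s lam δ u ≠ ⊤) (hb : b ≤ k) (hmj : m + 2 * j ≤ 2 * s) :
    eAniso0 T lam (δ + b + m) (mixDeriv T (b + m) j u) ≠ ⊤ := by
  unfold eAnisoKS at h
  have h1 := ENNReal.sum_ne_top.1 h b (Finset.mem_range.2 (by omega))
  have h2 := ENNReal.sum_ne_top.1 h1 m (Finset.mem_range.2 (by omega))
  have h3 := ENNReal.sum_ne_top.1 h2 j (Finset.mem_range.2 (by omega))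
  rwa [if_pos hmj] at h3

theorem abs_pd_le (i : Fin n) (f : Spc n → ℝ) (x : Spc n) : |pd i f x| ≤ ‖fderiv ℝ f x‖ := by
  have := (fderiv ℝ f x).le_opNorm (EuclideanSpace.single i 1)
  simpa [pd] using this

theorem tDeriv_zero (T : ℝ) (u : ℝ → Spc n → ℝ) (t : ℝ) : (fun x => tDeriv T 0 u t x) = u t := by
  funext x
  simp [tDeriv]

theorem FMemF.exists_bound {q k s : ℕ} {T lam lam' δ : ℝ} (hlam : 0 < lam) (hδ : 0 < δ)
    {u : FormT n q} (hu : FMemF T k s lam lam' δ u) :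
    ∃ W : ℝ, 0 ≤ W ∧ ∀ I, ∀ t ∈ Set.Icc (0 : ℝ) T, ∀ x,
      wt x ^ δ * |u I t x| ≤ W ∧ ∀ i, |pd i (u I t) x| ≤ W := by
  have key : ∀ I, ∃ W : ℝ, ∀ t ∈ Set.Icc (0 : ℝ) T, ∀ x,
      wt x ^ δ * |u I t x| ≤ W ∧ ∀ i, |pd i (u I t) x| ≤ W := by
    intro I
    have h1 : eFn T k s lam lam' δ (u I) ≠ ⊤ :=
      ENNReal.sum_ne_top.1 hu.2 I (Finset.mem_univ _)
    have h2 : eAnisoKS T (k + 1) s lam δ (u I) ≠ ⊤ := (ENNReal.add_ne_top.1 h1).1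
    obtain ⟨W₀, hW₀⟩ := exists_bound_of_eAniso0_ne_top hlam.ne'
      (eAniso0_ne_top_of_eAnisoKS (b := 0) (m := 0) (j := 0) h2 (by omega) (by omega))
    obtain ⟨W₁, hW₁⟩ := exists_bound_of_eAniso0_ne_top hlam.ne'
      (eAniso0_ne_top_of_eAnisoKS (b := 1) (m := 0) (j := 0) h2 (by omega) (by omega))
    refine ⟨max W₀ W₁, fun t ht x => ⟨le_max_of_le_left ?_, fun i => le_max_of_le_right ?_⟩⟩
    · have := hW₀ t ht x
      simpa [mixDeriv, tDeriv_zero] using this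
    · have h3 := hW₁ t ht x
      simp only [mixDeriv, tDeriv_zero] at h3
      have h4 : ‖iteratedFDeriv ℝ (1 + 0) (u I t) x‖ = ‖fderiv ℝ (u I t) x‖ :=
        norm_iteratedFDeriv_one _
      rw [h4] at h3
      refine (abs_pd_le i _ x).trans (le_trans ?_ h3)
      refine le_mul_of_one_le_left (norm_nonneg _) (Real.one_le_rpow (one_le_wt x) ?_)
      push_cast
      linarith
  choose W hW using key
  refine ⟨∑ I, |W I|, Finset.sum_nonneg fun _ _ => abs_nonneg _, fun I t ht x => ?_⟩
  have hle : W I ≤ ∑ I, |W I| := (le_abs_self _).trans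
    (Finset.single_le_sum (f := fun I => |W I|) (fun _ _ => abs_nonneg _) (Finset.mem_univ I))
  exact ⟨(hW I t ht x).1.trans hle, fun i => ((hW I t ht x).2 i).trans hle⟩

/-- A bilinear map between finite-dimensional spaces, as a continuous bilinear map. -/
def bilinToCLM {E F G : Type*} [NormedAddCommGroup E] [NormedSpace ℝ E] [FiniteDimensional ℝ E]
    [NormedAddCommGroup F] [NormedSpace ℝ F] [FiniteDimensional ℝ F]
    [NormedAddCommGroup G] [NormedSpace ℝ G] (M : E →ₗ[ℝ] F →ₗ[ℝ] G) : E →L[ℝ] F →L[ℝ] G :=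
  LinearMap.toContinuousLinearMap
    ((LinearMap.toContinuousLinearMap (𝕜 := ℝ) (E := F) (F' := G)).toLinearMap ∘ₗ M)

theorem abs_sum_le_mul {a : ℝ} (f : Fin n → ℝ) (hf : ∀ i, |f i| ≤ a) : |∑ i, f i| ≤ n * a := by
  refine (Finset.abs_sum_le_sum_abs _ _).trans ?_
  simpa using Finset.sum_le_card_nsmul Finset.univ (fun i => |f i|) a fun i _ => hf i

theorem abs_dS_le {q : ℕ} {v : FormS n q} {x : Spc n} {a : ℝ} (ha : 0 ≤ a)
    (h : ∀ I i, |pd i (v I) x| ≤ a) (J : Idx n (q + 1)) : |dS v J x| ≤ n * a := by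
  refine abs_sum_le_mul _ fun i => ?_
  split_ifs with hi
  · rw [abs_mul, abs_neg_one_pow, one_mul]
    exact h _ i
  · simpa using ha

theorem abs_dLowS_le {q : ℕ} {v : FormS n (q - 1)} {x : Spc n} {a : ℝ} (ha : 0 ≤ a)
    (h : ∀ K i, |pd i (v K) x| ≤ a) (I : Idx n q) : |dLowS v I x| ≤ n * a := by
  refine abs_sum_le_mul _ fun i => ?_
  split_ifs with hi
  · rw [abs_mul, abs_neg_one_pow, one_mul]
    exact h _ i
  · simpa using ha

theorem abs_coDS_le {q : ℕ} {v : FormS n q} {x : Spc n} {a : ℝ} (ha : 0 ≤ a)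
    (h : ∀ I i, |pd i (v I) x| ≤ a) (K : Idx n (q - 1)) : |coDS v K x| ≤ n * a := by
  rw [coDS, abs_neg]
  refine abs_sum_le_mul _ fun i => ?_
  split_ifs with hi
  · rw [abs_mul, abs_neg_one_pow, one_mul]
    exact h _ i
  · simpa using ha

theorem norm_fib_le {q : ℕ} (u : FormT n q) (t : ℝ) (x : Spc n) {r : ℝ} (hr : 0 ≤ r)
    (h : ∀ I, |u I t x| ≤ r) : ‖fib u t x‖ ≤ r :=
  (pi_norm_le_iff_of_nonneg hr).2 h

theorem norm_ddFib_le {q : ℕ} (u : FormT n q) (t : ℝ) (x : Spc n) {g : ℝ} (hg : 0 ≤ g)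
    (h : ∀ I i, |pd i (u I t) x| ≤ g) : ‖ddFib u t x‖ ≤ n * g := by
  have hng : 0 ≤ n * g := by positivity
  refine norm_prod_le_iff.2 ⟨(pi_norm_le_iff_of_nonneg hng).2 fun J => ?_,
    (pi_norm_le_iff_of_nonneg hng).2 fun K => ?_⟩
  · exact abs_dS_le (v := fun I => u I t) hg h J
  · exact abs_coDS_le (v := fun I => u I t) hg h K

theorem abs_pd_bilin_le {q : ℕ} (B : Fib n q →L[ℝ] Fib n q →L[ℝ] Fib n (q - 1))
    (u w : FormT n q) (t : ℝ) (x : Spc n)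
    (hu : ∀ I, DifferentiableAt ℝ (u I t) x) (hw : ∀ I, DifferentiableAt ℝ (w I t) x)
    {r g W : ℝ} (hr : 0 ≤ r) (hg : 0 ≤ g) (hW : 0 ≤ W)
    (hur : ∀ I, |u I t x| ≤ r) (hug : ∀ I i, |pd i (u I t) x| ≤ g)
    (hwr : ∀ I, |w I t x| ≤ W) (hwg : ∀ I i, |pd i (w I t) x| ≤ W)
    (K : Idx n (q - 1)) (i : Fin n) :
    DifferentiableAt ℝ (fun y => B (fib u t y) (fib w t y) K) x ∧
    |pd i (fun y => B (fib u t y) (fib w t y) K) x| ≤ ‖B‖ * W * (g + r) := by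
  have hU : HasFDerivAt (fun y => fib u t y)
      (ContinuousLinearMap.pi fun I => fderiv ℝ (u I t) x) x :=
    hasFDerivAt_pi.2 fun I => (hu I).hasFDerivAt
  have hV : HasFDerivAt (fun y => fib w t y)
      (ContinuousLinearMap.pi fun I => fderiv ℝ (w I t) x) x :=
    hasFDerivAt_pi.2 fun I => (hw I).hasFDerivAt
  have hB := hasFDerivAt_pi'.1 (B.hasFDerivAt_of_bilinear hU hV) K
  refine ⟨hB.differentiableAt, ?_⟩
  have e1 := norm_fib_le u t x hr hur
  have e2 := norm_fib_le w t x hW hwr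
  set du : Fib n q := fun I => pd i (u I t) x with hdu
  set dw : Fib n q := fun I => pd i (w I t) x with hdw
  have e3 : ‖du‖ ≤ g := (pi_norm_le_iff_of_nonneg hg).2 fun I => hug I i
  have e4 : ‖dw‖ ≤ W := (pi_norm_le_iff_of_nonneg hW).2 fun I => hwg I i
  have hval : pd i (fun y => B (fib u t y) (fib w t y) K) x
      = (B (fib u t x) dw + B du (fib w t x)) K := by
    rw [pd, hB.fderiv]
    rfl
  rw [hval]
  refine (norm_le_pi_norm (B (fib u t x) dw + B du (fib w t x)) K).trans ?_
  refine (norm_add_le _ _).trans ?_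
  have f1 : ‖B (fib u t x) dw‖ ≤ ‖B‖ * r * W :=
    (B.le_opNorm₂ _ _).trans (by gcongr)
  have f2 : ‖B du (fib w t x)‖ ≤ ‖B‖ * g * W :=
    (B.le_opNorm₂ _ _).trans (by gcongr)
  nlinarith

theorem exists_abs_Bop_le {q : ℕ} (M₁ : M1Type n q) (M₂ : M2Type n q) :
    ∃ C : ℝ, 0 ≤ C ∧ ∀ (u w : FormT n q) (t : ℝ) (x : Spc n) (r g W : ℝ),
      (∀ I, DifferentiableAt ℝ (u I t) x) → (∀ I, DifferentiableAt ℝ (w I t) x) →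
      0 ≤ r → 0 ≤ g → 0 ≤ W →
      (∀ I, |u I t x| ≤ r) → (∀ I i, |pd i (u I t) x| ≤ g) →
      (∀ I, |w I t x| ≤ W) → (∀ I i, |pd i (w I t) x| ≤ W) →
      ∀ I, |Bop M₁ M₂ w u I t x| ≤ C * W * (g + r) := by
  set B₁ := bilinToCLM M₁
  set B₂ := bilinToCLM M₂
  refine ⟨n * ‖B₁‖ + n * (2 * ‖B₂‖), by positivity, ?_⟩
  intro u w t x r g W hu hw hr hg hW hur hug hwr hwg I
  have a1 : ‖B₁ (ddFib u t x) (fib w t x)‖ ≤ ‖B₁‖ * (n * g) * W :=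
    (B₁.le_opNorm₂ _ _).trans (by
      gcongr
      exacts [norm_ddFib_le u t x hg hug, norm_fib_le w t x hW hwr])
  have a2 : ‖B₁ (ddFib w t x) (fib u t x)‖ ≤ ‖B₁‖ * (n * W) * r :=
    (B₁.le_opNorm₂ _ _).trans (by
      gcongr
      exacts [norm_ddFib_le w t x hW hwg, norm_fib_le u t x hr hur])
  have hWop : |Wop M₁ w u I t x| ≤ n * ‖B₁‖ * W * (g + r) := by
    have b1 := (norm_le_pi_norm (B₁ (ddFib u t x) (fib w t x)) I).trans a1
    have b2 := (norm_le_pi_norm (B₁ (ddFib w t x) (fib u t x)) I).trans a2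
    rw [Real.norm_eq_abs] at b1 b2
    refine (abs_add_le _ _).trans ((add_le_add b1 b2).trans (le_of_eq ?_))
    ring
  have hpd : ∀ (K : Idx n (q - 1)) (i : Fin n),
      |pd i (fun y => M₂ (fib u t y) (fib w t y) K + M₂ (fib w t y) (fib u t y) K) x|
        ≤ 2 * ‖B₂‖ * W * (g + r) := by
    intro K i
    obtain ⟨d1, c1⟩ := abs_pd_bilin_le B₂ u w t x hu hw hr hg hW hur hug hwr hwg K i
    obtain ⟨d2, c2⟩ := abs_pd_bilin_le B₂.flip u w t x hu hw hr hg hW hur hug hwr hwg K i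
    rw [ContinuousLinearMap.opNorm_flip] at c2
    have : pd i (fun y => M₂ (fib u t y) (fib w t y) K + M₂ (fib w t y) (fib u t y) K) x
        = pd i (fun y => B₂ (fib u t y) (fib w t y) K) x
          + pd i (fun y => B₂.flip (fib u t y) (fib w t y) K) x := by
      have := fderiv_add d1 d2
      exact congrArg (fun L => L (EuclideanSpace.single i 1)) this
    rw [this]
    refine (abs_add_le _ _).trans ((add_le_add c1 c2).trans (le_of_eq ?_))
    ring
  have hlow : |dLowT (fun K t' x' => M₂ (fib u t' x') (fib w t' x') K
      + M₂ (fib w t' x') (fib u t' x') K) I t x| ≤ n * (2 * ‖B₂‖ * W * (g + r)) :=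
    abs_dLowS_le (by positivity) hpd I
  refine (abs_add_le _ _).trans ((add_le_add hWop hlow).trans (le_of_eq ?_))
  ring

theorem hasDerivAt_sq {f : ℝ → ℝ} {f' a : ℝ} (hf : HasDerivAt f f' a) :
    HasDerivAt (fun y => f y ^ 2) (2 * (f a * f')) a := by
  have h : 2 * (f a * f') = ((2 : ℕ) : ℝ) * f a ^ (2 - 1) * f' := by
    norm_num
    ring
  rw [h]
  exact hf.pow 2

theorem hasDerivAt_line {f : Spc n → ℝ} (hf : Differentiable ℝ f) (i : Fin n) (x : Spc n) (a : ℝ) :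
    HasDerivAt (fun a : ℝ => f (x + a • EuclideanSpace.single i (1 : ℝ)))
      (pd i f (x + a • EuclideanSpace.single i (1 : ℝ))) a := by
  have h1 : HasDerivAt (fun a : ℝ => x + a • EuclideanSpace.single i (1 : ℝ))
      (EuclideanSpace.single i (1 : ℝ)) a := by
    simpa using ((hasDerivAt_id a).smul_const (EuclideanSpace.single i (1 : ℝ))).const_add x
  exact (hf _).hasFDerivAt.comp_hasDerivAt a h1

theorem deriv_deriv_nonpos_of_isLocalMax {h : ℝ → ℝ} {a : ℝ} (hc : ContinuousAt h a)
    (hmax : IsLocalMax h a) : deriv (deriv h) a ≤ 0 := by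
  by_contra! hpos
  have hmin := isLocalMin_of_deriv_deriv_pos hpos hmax.deriv_eq_zero hc
  have heq : h =ᶠ[nhds a] fun _ => h a := by
    filter_upwards [hmax, hmin] with y h1 h2
    exact le_antisymm h1 h2
  have : deriv (deriv h) a = 0 := by
    rw [heq.deriv.deriv_eq]
    simp
  exact hpos.ne' this

theorem differentiable_pd {f : Spc n → ℝ} (hf : ContDiff ℝ 2 f) (i : Fin n) :
    Differentiable ℝ (pd i f) := by
  have h := (hf.fderiv_right (m := 1) (by norm_num)).differentiable one_ne_zero
  exact fun x => (h x).clm_apply (differentiableAt_const _)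

theorem sum_sq_pd_le_of_isMax {q : ℕ} (v : FormS n q) (hv : ∀ I, ContDiff ℝ 2 (v I)) (x : Spc n)
    (hmax : ∀ y, ∑ I, v I y ^ 2 ≤ ∑ I, v I x ^ 2) :
    ∑ I, ∑ i, pd i (v I) x ^ 2 ≤ -∑ I, v I x * lap (v I) x := by
  have key : ∀ i : Fin n, ∑ I, (pd i (v I) x ^ 2 + v I x * pd i (pd i (v I)) x) ≤ 0 := by
    intro i
    set L : ℝ → Spc n := fun a => x + a • EuclideanSpace.single i (1 : ℝ) with hL
    have hL0 : L 0 = x := by simp [hL]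
    have d1 : ∀ a, HasDerivAt (fun a => ∑ I, v I (L a) ^ 2)
        (∑ I, 2 * (v I (L a) * pd i (v I) (L a))) a := fun a =>
      HasDerivAt.fun_sum fun I _ =>
        hasDerivAt_sq (hasDerivAt_line ((hv I).differentiable two_ne_zero) i x a)
    have d2 : HasDerivAt (fun a => ∑ I, 2 * (v I (L a) * pd i (v I) (L a)))
        (∑ I, 2 * (pd i (v I) (L 0) * pd i (v I) (L 0)
          + v I (L 0) * pd i (pd i (v I)) (L 0))) 0 :=
      HasDerivAt.fun_sum fun I _ =>
        ((hasDerivAt_line ((hv I).differentiable two_ne_zero) i x 0).mul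
          (hasDerivAt_line (differentiable_pd (hv I) i) i x 0)).const_mul 2
    have hloc : IsLocalMax (fun a => ∑ I, v I (L a) ^ 2) 0 := by
      refine Eventually.of_forall fun a => ?_
      simp only [hL0]
      exact hmax _
    have h2 := deriv_deriv_nonpos_of_isLocalMax (d1 0).continuousAt hloc
    rw [funext fun a => (d1 a).deriv, d2.deriv, hL0, ← Finset.mul_sum] at h2
    have : ∑ I, (pd i (v I) x ^ 2 + v I x * pd i (pd i (v I)) x)
        = ∑ I, (pd i (v I) x * pd i (v I) x + v I x * pd i (pd i (v I)) x) := by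
      simp only [sq]
    linarith
  have hsum := Finset.sum_nonpos fun i (_ : i ∈ Finset.univ) => key i
  rw [Finset.sum_comm] at hsum
  simp only [Finset.sum_add_distrib] at hsum
  simp only [lap, Finset.mul_sum]
  linarith

theorem deriv_nonneg_of_isMaxOn_Icc {f : ℝ → ℝ} {a b f' : ℝ} (hab : a < b)
    (hf : HasDerivAt f f' b) (hmax : ∀ y ∈ Set.Icc a b, f y ≤ f b) : 0 ≤ f' := by
  have h := (hasDerivAt_iff_tendsto_slope.1 hf).mono_left
    (nhdsWithin_mono b (fun y (hy : y < b) => hy.ne) : nhdsWithin b (Set.Iio b) ≤ _)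
  refine ge_of_tendsto h ?_
  filter_upwards [Ioo_mem_nhdsLT hab] with y hy
  rw [slope_def_field]
  exact div_nonneg_of_nonpos (by linarith [hmax y ⟨hy.1.le, hy.2.le⟩]) (by linarith [hy.2])

theorem exists_isMax_of_decay {T' : ℝ} (ψ : ℝ → Spc n → ℝ) {A δ : ℝ} (hδ : 0 < δ)
    (hcont : ContinuousOn (fun p : ℝ × Spc n => ψ p.1 p.2) (Set.Icc 0 T' ×ˢ Set.univ))
    (hdec : ∀ t ∈ Set.Icc 0 T', ∀ x, wt x ^ δ * ψ t x ≤ A)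
    {t₁ : ℝ} (ht₁ : t₁ ∈ Set.Icc 0 T') {x₁ : Spc n} (hpos : 0 < ψ t₁ x₁) :
    ∃ t₀ ∈ Set.Icc 0 T', ∃ x₀, ψ t₁ x₁ ≤ ψ t₀ x₀ ∧ ∀ t ∈ Set.Icc 0 T', ∀ x, ψ t x ≤ ψ t₀ x₀ := by
  obtain ⟨R, hR⟩ : ∃ R : ℝ, ∀ y : ℝ, R ≤ y → A / ψ t₁ x₁ < y ^ δ := by
    have := (tendsto_rpow_atTop hδ).eventually_gt_atTop (A / ψ t₁ x₁)
    exact eventually_atTop.1 this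
  set R' := max R ‖x₁‖ with hR'
  have hcomp : IsCompact (Set.Icc 0 T' ×ˢ Metric.closedBall (0 : Spc n) R') :=
    isCompact_Icc.prod (isCompact_closedBall _ _)
  have hmem : (t₁, x₁) ∈ Set.Icc 0 T' ×ˢ Metric.closedBall (0 : Spc n) R' :=
    ⟨ht₁, by simp [hR']⟩
  obtain ⟨⟨t₀, x₀⟩, h₀, hmax⟩ := hcomp.exists_isMaxOn ⟨_, hmem⟩
    (hcont.mono (Set.prod_mono_right (Set.subset_univ _)))
  have h10 : ψ t₁ x₁ ≤ ψ t₀ x₀ := hmax hmem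
  refine ⟨t₀, h₀.1, x₀, h10, fun t ht x => ?_⟩
  by_cases hx : ‖x‖ ≤ R'
  · exact hmax (show (t, x) ∈ Set.Icc 0 T' ×ˢ Metric.closedBall (0 : Spc n) R' from
      ⟨ht, by simpa using hx⟩)
  · refine le_trans ?_ h10
    have h1 : A / ψ t₁ x₁ < wt x ^ δ :=
      hR _ ((le_max_left _ _).trans ((not_le.1 hx).le.trans (norm_le_wt x)))
    rw [div_lt_iff₀ hpos] at h1
    have h2 := hdec t ht x
    have h3 : 0 < wt x ^ δ := Real.rpow_pos_of_pos (one_pos.trans_le (one_le_wt x)) _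
    exact le_of_mul_le_mul_left (h2.trans h1.le) h3

theorem FMemF.continuousOn {q k s : ℕ} {T lam lam' δ : ℝ} {u : FormT n q}
    (hu : FMemF T k s lam lam' δ u) (I : Idx n q) :
    ContinuousOn (fun p : ℝ × Spc n => u I p.1 p.2) (Set.Icc 0 T ×ˢ Set.univ) := by
  have h := (hu.1 I).2.2 0 0 (by omega) (by omega)
  have h' : Continuous fun p : Set.Icc (0 : ℝ) T × Spc n => u I p.1 p.2 := by
    have e : (fun p : Set.Icc (0 : ℝ) T × Spc n => u I p.1 p.2)
        = fun p => mixDeriv T 0 0 (u I) p.1 p.2 0 := by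
      funext p
      simp [mixDeriv, tDeriv_zero]
    rw [e]
    exact (ContinuousMultilinearMap.apply ℝ (fun _ : Fin 0 => Spc n) ℝ 0).continuous.comp h
  rw [continuousOn_iff_continuous_domRestrict]
  have hmap : Continuous fun p : (Set.Icc (0 : ℝ) T ×ˢ (Set.univ : Set (Spc n)) : Set _) =>
      ((⟨p.1.1, p.2.1⟩, p.1.2) : Set.Icc (0 : ℝ) T × Spc n) := by fun_prop
  exact h'.comp hmap

theorem FMemF.contDiff_two {q k s : ℕ} {T lam lam' δ : ℝ} {u : FormT n q} (hs : 1 ≤ s)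
    (hu : FMemF T k s lam lam' δ u) (I : Idx n q) {t : ℝ} (ht : t ∈ Set.Icc 0 T) :
    ContDiff ℝ 2 (u I t) := by
  have h := (hu.1 I).2.1 0 (by omega) t ht
  rw [tDeriv_zero] at h
  refine h.of_le ?_
  have : (2 : WithTop ℕ∞) ≤ ((2 * s + (k + 1) : ℕ) : WithTop ℕ∞) := by
    exact_mod_cast (by omega : 2 ≤ 2 * s + (k + 1))
  simpa using this

theorem FMemF.differentiableAt_time {q k s : ℕ} {T lam lam' δ : ℝ} {u : FormT n q} (hs : 1 ≤ s)
    (hu : FMemF T k s lam lam' δ u) (I : Idx n q) {t : ℝ} (ht : t ∈ Set.Ioo 0 T) (x : Spc n) :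
    DifferentiableAt ℝ (fun τ => u I τ x) t :=
  (((hu.1 I).1 x).differentiableOn (by exact_mod_cast (by omega : s ≠ 0))).differentiableAt
    (Icc_mem_nhds ht.1 ht.2)

/-- Uniqueness on the half-open time interval, by the maximum principle for `e^{-Kt} |u|²`. -/
theorem eq_zero_of_lt {q s k : ℕ} (hs : 1 ≤ s)
    {lam lam' δ μ T : ℝ} (h1 : 0 < lam) (hδ : 0 < δ) (hμ : 0 < μ)
    (M₁ : M1Type n q) (M₂ : M2Type n q) {w : FormT n q}
    (hw : FMemF T k s lam lam' δ w) {u : FormT n q} (hu : FMemF T k s lam lam' δ u)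
    (hpde : ∀ I, ∀ t ∈ Set.Ioo (0 : ℝ) T, ∀ x,
      deriv (fun τ => u I τ x) t - μ * lap (fun y => u I t y) x + Bop M₁ M₂ w u I t x = 0)
    (hinit : ∀ I x, u I 0 x = 0) (I : Idx n q) {T' : ℝ} (hT' : T' ∈ Set.Ico 0 T) (x₁ : Spc n) :
    u I T' x₁ = 0 := by
  by_contra hne
  obtain ⟨W, hW0, hW⟩ := hw.exists_bound h1 hδ
  obtain ⟨U, hU0, hU⟩ := hu.exists_bound h1 hδ
  obtain ⟨C, hC0, hC⟩ := exists_abs_Bop_le M₁ M₂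
  have hwtδ : ∀ x : Spc n, 1 ≤ wt x ^ δ := fun x => Real.one_le_rpow (one_le_wt x) hδ.le
  set N : ℝ := (Fintype.card (Idx n q) : ℝ) with hN
  set D : ℝ := N * (C * W) with hD
  have hD0 : 0 ≤ D := by positivity
  set K : ℝ := D ^ 2 / (2 * μ) + 2 * D + 1 with hK
  have hK0 : 0 < K := by positivity
  set φ : ℝ → Spc n → ℝ := fun t x => ∑ I, u I t x ^ 2 with hφ
  set ψ : ℝ → Spc n → ℝ := fun t x => Real.exp (-K * t) * φ t x with hψ
  have hφ0 : ∀ t x, 0 ≤ φ t x := fun t x => Finset.sum_nonneg fun _ _ => sq_nonneg _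
  have hsub : Set.Icc 0 T' ⊆ Set.Icc 0 T := Set.Icc_subset_Icc_right hT'.2.le
  have hcont : ContinuousOn (fun p : ℝ × Spc n => ψ p.1 p.2) (Set.Icc 0 T' ×ˢ Set.univ) := by
    refine ContinuousOn.mul (by fun_prop) (continuousOn_finsetSum _ fun I _ => ?_)
    exact ((hu.continuousOn I).mono (Set.prod_mono_left hsub)).pow 2
  have hdec : ∀ t ∈ Set.Icc 0 T', ∀ x, wt x ^ δ * ψ t x ≤ N * U ^ 2 := by
    intro t ht x
    have hexp : Real.exp (-K * t) ≤ 1 := Real.exp_le_one_iff.2 (by nlinarith [ht.1])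
    have hle : wt x ^ δ * φ t x ≤ N * U ^ 2 := by
      simp only [hφ, Finset.mul_sum]
      have : ∀ I ∈ (Finset.univ : Finset (Idx n q)), wt x ^ δ * u I t x ^ 2 ≤ U ^ 2 := by
        intro I _
        have a1 := (hU I t (hsub ht) x).1
        have a2 : |u I t x| ≤ U :=
          (le_mul_of_one_le_left (abs_nonneg _) (hwtδ x)).trans a1
        calc wt x ^ δ * u I t x ^ 2 = (wt x ^ δ * |u I t x|) * |u I t x| := by
              rw [← sq_abs]; ring
          _ ≤ U * U := by gcongr
          _ = U ^ 2 := by ring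
      simpa [hN] using Finset.sum_le_card_nsmul _ _ _ this
    calc wt x ^ δ * ψ t x = Real.exp (-K * t) * (wt x ^ δ * φ t x) := by simp only [hψ]; ring
      _ ≤ 1 * (wt x ^ δ * φ t x) := by
          have := hφ0 t x
          have := hwtδ x
          gcongr
      _ ≤ N * U ^ 2 := by rw [one_mul]; exact hle
  have hpos : 0 < ψ T' x₁ := by
    refine mul_pos (Real.exp_pos _) ?_
    exact Finset.sum_pos' (fun _ _ => sq_nonneg _) ⟨I, Finset.mem_univ _, by positivity⟩
  obtain ⟨t₀, ht₀, x₀, hge, hmax⟩ := exists_isMax_of_decay ψ hδ hcont hdec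
    ⟨hT'.1, le_rfl⟩ hpos
  have hψ₀ : 0 < ψ t₀ x₀ := hpos.trans_le hge
  have hφ₀ : 0 < φ t₀ x₀ := pos_of_mul_pos_right hψ₀ (Real.exp_pos _).le
  have ht₀pos : 0 < t₀ := by
    refine lt_of_le_of_ne ht₀.1 fun h0 => hφ₀.ne' ?_
    simp [hφ, ← h0, hinit]
  have ht₀T : t₀ ∈ Set.Ioo 0 T := ⟨ht₀pos, ht₀.2.trans_lt hT'.2⟩
  have ht₀T' : t₀ ∈ Set.Icc 0 T := ⟨ht₀T.1.le, ht₀T.2.le⟩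
  have hC2u : ∀ I, ContDiff ℝ 2 (u I t₀) := fun I => hu.contDiff_two hs I ht₀T'
  have hC2w : ∀ I, ContDiff ℝ 2 (w I t₀) := fun I => hw.contDiff_two hs I ht₀T'
  set G : ℝ := ∑ I, ∑ i, pd i (u I t₀) x₀ ^ 2 with hG
  have hspace : G ≤ -∑ I, u I t₀ x₀ * lap (u I t₀) x₀ := by
    refine sum_sq_pd_le_of_isMax (fun I => u I t₀) hC2u x₀ fun y => ?_
    exact le_of_mul_le_mul_left (hmax t₀ ht₀ y) (Real.exp_pos _)
  have htime : K * φ t₀ x₀ ≤ 2 * ∑ I, u I t₀ x₀ * deriv (fun τ => u I τ x₀) t₀ := by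
    have dφ : HasDerivAt (fun t => φ t x₀)
        (∑ I, 2 * (u I t₀ x₀ * deriv (fun τ => u I τ x₀) t₀)) t₀ :=
      HasDerivAt.fun_sum fun I _ =>
        hasDerivAt_sq (hu.differentiableAt_time hs I ht₀T x₀).hasDerivAt
    have dexp : HasDerivAt (fun t => Real.exp (-K * t)) (Real.exp (-K * t₀) * -K) t₀ := by
      simpa using ((hasDerivAt_id t₀).const_mul (-K)).exp
    have hd := deriv_nonneg_of_isMaxOn_Icc ht₀pos (dexp.mul dφ) fun y hy =>
      hmax y ⟨hy.1, hy.2.trans ht₀.2⟩ x₀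
    rw [← Finset.mul_sum] at hd
    have : 0 ≤ Real.exp (-K * t₀) * (2 * (∑ I, u I t₀ x₀ * deriv (fun τ => u I τ x₀) t₀)
        - K * φ t₀ x₀) := by
      refine hd.trans (le_of_eq ?_)
      ring
    linarith [nonneg_of_mul_nonneg_right this (Real.exp_pos _)]
  set r : ℝ := Real.sqrt (φ t₀ x₀) with hr
  set g : ℝ := Real.sqrt G with hg
  have hG0 : 0 ≤ G := Finset.sum_nonneg fun _ _ => Finset.sum_nonneg fun _ _ => sq_nonneg _
  have hr2 : r ^ 2 = φ t₀ x₀ := Real.sq_sqrt hφ₀.le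
  have hg2 : g ^ 2 = G := Real.sq_sqrt hG0
  have hr0 : 0 ≤ r := Real.sqrt_nonneg _
  have hg0 : 0 ≤ g := Real.sqrt_nonneg _
  have hur : ∀ I, |u I t₀ x₀| ≤ r := fun I => Real.abs_le_sqrt
    (Finset.single_le_sum (f := fun I => u I t₀ x₀ ^ 2) (fun _ _ => sq_nonneg _)
      (Finset.mem_univ I))
  have hug : ∀ I i, |pd i (u I t₀) x₀| ≤ g := fun I i => Real.abs_le_sqrt
    ((Finset.single_le_sum (f := fun i => pd i (u I t₀) x₀ ^ 2) (fun _ _ => sq_nonneg _)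
      (Finset.mem_univ i)).trans
      (Finset.single_le_sum (f := fun I => ∑ i, pd i (u I t₀) x₀ ^ 2)
        (fun _ _ => Finset.sum_nonneg fun _ _ => sq_nonneg _) (Finset.mem_univ I)))
  have hB : ∀ I, |Bop M₁ M₂ w u I t₀ x₀| ≤ C * W * (g + r) :=
    hC u w t₀ x₀ r g W (fun I => (hC2u I).differentiable two_ne_zero _)
      (fun I => (hC2w I).differentiable two_ne_zero _) hr0 hg0 hW0 hur hug
      (fun I => (le_mul_of_one_le_left (abs_nonneg _) (hwtδ x₀)).trans (hW I t₀ ht₀T' x₀).1)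
      (fun I i => (hW I t₀ ht₀T' x₀).2 i)
  have huB : -∑ I, u I t₀ x₀ * Bop M₁ M₂ w u I t₀ x₀ ≤ D * r * (g + r) := by
    rw [← Finset.sum_neg_distrib]
    have : ∀ I ∈ (Finset.univ : Finset (Idx n q)),
        -(u I t₀ x₀ * Bop M₁ M₂ w u I t₀ x₀) ≤ r * (C * W * (g + r)) := by
      intro I _
      refine (neg_le_abs _).trans ?_
      rw [abs_mul]
      exact mul_le_mul (hur I) (hB I) (abs_nonneg _) hr0
    refine (Finset.sum_le_card_nsmul _ _ _ this).trans (le_of_eq ?_)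
    simp only [Finset.card_univ, nsmul_eq_mul, hD, hN]
    ring
  have hsum : ∑ I, u I t₀ x₀ * deriv (fun τ => u I τ x₀) t₀
      = μ * ∑ I, u I t₀ x₀ * lap (u I t₀) x₀ - ∑ I, u I t₀ x₀ * Bop M₁ M₂ w u I t₀ x₀ := by
    rw [Finset.mul_sum, ← Finset.sum_sub_distrib]
    refine Finset.sum_congr rfl fun I _ => ?_
    linear_combination u I t₀ x₀ * hpde I t₀ ht₀T x₀
  have hfin : K * r ^ 2 ≤ -(2 * μ * g ^ 2) + 2 * (D * r * (g + r)) := by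
    rw [hr2, hg2]
    have := mul_le_mul_of_nonneg_left hspace hμ.le
    nlinarith
  have hsq : 2 * (D * r * g) ≤ 2 * μ * g ^ 2 + D ^ 2 / (2 * μ) * r ^ 2 := by
    have h := sq_nonneg (2 * μ * g - D * r)
    have e : 2 * μ * g ^ 2 + D ^ 2 / (2 * μ) * r ^ 2 - 2 * (D * r * g)
        = (2 * μ * g - D * r) ^ 2 / (2 * μ) := by
      field_simp
      ring
    have : 0 ≤ (2 * μ * g - D * r) ^ 2 / (2 * μ) := by positivity
    linarith
  have : 0 < r ^ 2 := hr2 ▸ hφ₀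
  rw [hK] at hfin
  nlinarith

/-- uniqueness for the linear Cauchy problem
`∂_t u - μΔu + B_q(w,u) = 0`, `u(·,0) = 0`. -/
theorem stmt9 (n q s k : ℕ) (hn : 2 ≤ n) (hq : q ≤ n) (hs : 1 ≤ s) (hk : 1 ≤ k)
    (lam lam' δ μ T : ℝ) (h1 : 0 < lam) (h2 : lam < lam') (h3 : lam' < 1)
    (hδ : (n : ℝ) / 2 < δ) (hμ : 0 < μ) (hT : 0 < T)
    (M₁ : M1Type n q) (M₂ : M2Type n q) (w : FormT n q)
    (hw : FMemF T k s lam lam' δ w)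
    (u : FormT n q) (hu : FMemF T k s lam lam' δ u)
    (hpde : ∀ I, ∀ t ∈ Set.Ioo (0 : ℝ) T, ∀ x,
      deriv (fun τ => u I τ x) t - μ * lap (fun y => u I t y) x
        + Bop M₁ M₂ w u I t x = 0)
    (hinit : ∀ I x, u I 0 x = 0) :
    EqOnT T u 0 := by
  have hδ0 : 0 < δ := lt_of_le_of_lt (by positivity) hδ
  intro I t ht x
  have hcont : ContinuousOn (fun τ => u I τ x) (Set.Icc 0 T) := ((hu.1 I).1 x).continuousOn
  have hzero : Set.EqOn (fun τ => u I τ x) (fun _ => 0) (Set.Ico 0 T) := fun τ hτ =>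
    eq_zero_of_lt hs h1 hδ0 hμ M₁ M₂ hw hu hpde hinit I hτ x
  exact hzero.of_subset_closure hcont continuousOn_const Set.Ico_subset_Icc_self
    (by rw [closure_Ico hT.ne]) ht
end NSdeRham

end
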